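/- arXiv:2109.01875 — 3 statements merged into one kernel-verified Lean document; each statement's English description precedes it below -/
import Mathlib

section
/- Let G = (V, E) be a finite simple bipartite graph with a weight function w : E → ℤ, and suppose G has a perfect matching. Let W* be the minimum of w(M) over all perfect matchings M of G, and let E₁ ⊆ E be the union of the edge sets of all perfect matchings M with w(M) = W*. Then: (a) if C is a cycle in G with circulation c_w(C) ≠ 0, then not every edge of C belongs to E₁; and (b) every perfect matching of G all of whose edges belong to E₁ has weight exactly W*. -/
/-- Alternating sum of weights along a list of edges:
`w e₁ - w e₂ + w e₃ - ⋯`. -/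
def altSum {V : Type*} (w : Sym2 V → ℤ) : List (Sym2 V) → ℤ
  | [] => 0
  | e :: es => w e - altSum w es

/-- `M` is a perfect matching of `G`: a set of edges of `G` such that every vertex
belongs to exactly one edge of `M` (in particular the edges are pairwise disjoint
and cover every vertex). -/
def IsPerfectMatchingSet {V : Type*} (G : SimpleGraph V) (M : Finset (Sym2 V)) : Prop :=
  (↑M ⊆ G.edgeSet) ∧ ∀ v : V, ∃! e, e ∈ M ∧ v ∈ e

open Classical in
/-- A permutation of a bipartite graph along edges splits into two perfect matchings. -/
theorem perm_matching {V : Type*} [Fintype V] (G : SimpleGraph V) (C : G.Coloring (Fin 2))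
    (w : Sym2 V → ℤ) (σ : Equiv.Perm V) (hσ : ∀ v, G.Adj v (σ v)) (i : Fin 2) :
    ∃ M : Finset (Sym2 V), IsPerfectMatchingSet G M ∧
      ∑ e ∈ M, w e = ∑ v ∈ Finset.univ.filter (fun v => C v = i), w s(v, σ v) := by
  have hC : ∀ v, C v ≠ C (σ v) := fun v => C.valid (hσ v)
  refine ⟨(Finset.univ.filter (fun v => C v = i)).image (fun v => s(v, σ v)), ⟨?_, ?_⟩, ?_⟩
  · intro e he
    simp only [Finset.coe_image, Set.mem_image, Finset.mem_coe] at he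
    obtain ⟨v, -, rfl⟩ := he
    exact hσ v
  · intro v
    by_cases hv : C v = i
    · refine ⟨s(v, σ v), ⟨Finset.mem_image_of_mem _ (by simp [hv]), by simp⟩, ?_⟩
      rintro e ⟨he, hve⟩
      simp only [Finset.mem_image, Finset.mem_filter, Finset.mem_univ, true_and] at he
      obtain ⟨a, ha, rfl⟩ := he
      rcases Sym2.mem_iff.1 hve with rfl | rfl
      · rfl
      · exact absurd (ha.trans hv.symm) (hC a)
    · have h1 : C (σ.symm v) = i := by
        have := hC (σ.symm v)
        rw [Equiv.apply_symm_apply] at this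
        omega
      refine ⟨s(σ.symm v, v), ⟨?_, by simp⟩, ?_⟩
      · exact Finset.mem_image.2 ⟨σ.symm v, by simp [h1], by simp⟩
      rintro e ⟨he, hve⟩
      simp only [Finset.mem_image, Finset.mem_filter, Finset.mem_univ, true_and] at he
      obtain ⟨a, ha, rfl⟩ := he
      rcases Sym2.mem_iff.1 hve with rfl | rfl
      · exact absurd ha hv
      · simp
  · rw [Finset.sum_image]
    intro a ha b hb hab
    simp only [Finset.coe_filter, Finset.mem_univ, true_and, Set.mem_ofPred_eq] at ha hb
    rcases Sym2.eq_iff.1 hab with h | h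
    · exact h.1
    · exact absurd (by rw [← h.1, ha, hb] : C b = C (σ b)) (hC b)

open Classical in
theorem perm_weight {V : Type*} [Fintype V] (G : SimpleGraph V) (C : G.Coloring (Fin 2))
    (w : Sym2 V → ℤ) (W : ℤ)
    (hW : ∀ M : Finset (Sym2 V), IsPerfectMatchingSet G M → W ≤ ∑ e ∈ M, w e)
    (σ : Equiv.Perm V) (hσ : ∀ v, G.Adj v (σ v)) :
    2 * W ≤ ∑ v, w s(v, σ v) := by
  obtain ⟨M, hM, hMs⟩ := perm_matching G C w σ hσ 0
  obtain ⟨N, hN, hNs⟩ := perm_matching G C w σ hσ 1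
  have h1 := hW M hM
  have h2 := hW N hN
  rw [← Finset.sum_filter_add_sum_filter_not Finset.univ (fun v => C v = 0)]
  have : ∀ v, (¬ C v = 0) ↔ C v = 1 := fun v => by omega
  simp only [this]
  omega

/-- Birkhoff: a nonnegative `k`-regular matrix supported on `G` has weight at least `2kW`. -/
theorem regular_weight {V : Type*} [Fintype V] (G : SimpleGraph V) (C : G.Coloring (Fin 2))
    (w : Sym2 V → ℤ) (W : ℤ)
    (hW : ∀ M : Finset (Sym2 V), IsPerfectMatchingSet G M → W ≤ ∑ e ∈ M, w e)
    (F : V → V → ℚ) (k : ℚ) (hk : 0 ≤ k) (h0 : ∀ u v, 0 ≤ F u v)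
    (hG : ∀ u v, ¬ G.Adj u v → F u v = 0)
    (hr : ∀ u, ∑ v, F u v = k) (hc : ∀ v, ∑ u, F u v = k) :
    2 * k * W ≤ ∑ u, ∑ v, F u v * w s(u, v) := by
  classical
  rcases hk.eq_or_lt with rfl | hk
  · have : ∀ u v, F u v = 0 := fun u v =>
      (Finset.sum_eq_zero_iff_of_nonneg (fun v _ => h0 u v)).1 (hr u) v (Finset.mem_univ _)
    simp [this]
  have hds : Matrix.of (fun u v => k⁻¹ * F u v) ∈ doublyStochastic ℚ V := by
    rw [mem_doublyStochastic_iff_sum]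
    refine ⟨fun i j => mul_nonneg (inv_nonneg.2 hk.le) (h0 i j), fun i => ?_, fun j => ?_⟩
    · simp only [Matrix.of_apply, ← Finset.mul_sum, hr]
      exact inv_mul_cancel₀ hk.ne'
    · simp only [Matrix.of_apply, ← Finset.mul_sum, hc]
      exact inv_mul_cancel₀ hk.ne'
  obtain ⟨c, hc0, hc1, hcF⟩ := exists_eq_sum_perm_of_mem_doublyStochastic hds
  have hF : ∀ u v, F u v = k * ∑ σ : Equiv.Perm V, c σ * (if σ u = v then 1 else 0) := by
    intro u v
    have := congrFun (congrFun hcF u) v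
    simp only [Matrix.sum_apply, Matrix.smul_apply, PEquiv.toMatrix_apply, Equiv.toPEquiv_apply,
      Option.mem_some_iff, Matrix.of_apply, smul_eq_mul] at this
    rw [this, mul_inv_cancel_left₀ hk.ne']
  have hsupp : ∀ σ, c σ ≠ 0 → ∀ u, G.Adj u (σ u) := by
    intro σ hσ u
    by_contra hn
    have h := hG _ _ hn
    rw [hF, mul_eq_zero] at h
    have h := h.resolve_left hk.ne'
    rw [Finset.sum_eq_zero_iff_of_nonneg
      (fun τ _ => mul_nonneg (hc0 τ) (by split_ifs <;> norm_num))] at h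
    have := h σ (Finset.mem_univ _)
    simp at this
    exact hσ this
  have key : ∑ u, ∑ v, F u v * w s(u, v) = k * ∑ σ, c σ * ∑ u, (w s(u, σ u) : ℚ) := by
    simp only [hF, Finset.mul_sum, Finset.sum_mul]
    rw [Finset.sum_comm' (t' := Finset.univ) (s' := fun _ => Finset.univ) (by simp)]
    rw [Finset.sum_comm]
    conv_rhs => rw [Finset.sum_comm]
    refine Finset.sum_congr rfl fun u _ => ?_
    rw [Finset.sum_comm]
    refine Finset.sum_congr rfl fun σ _ => ?_
    rw [Finset.sum_eq_single (σ u)]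
    · simp [mul_assoc]
    · intro b _ hb
      simp [hb.symm]
    · simp
  rw [key]
  have : (2 * W : ℚ) ≤ ∑ σ, c σ * ∑ u, (w s(u, σ u) : ℚ) := by
    calc (2 * W : ℚ) = ∑ σ, c σ * (2 * W : ℚ) := by rw [← Finset.sum_mul, hc1, one_mul]
      _ ≤ _ := by
        refine Finset.sum_le_sum fun σ _ => ?_
        by_cases h : c σ = 0
        · simp [h]
        · refine mul_le_mul_of_nonneg_left ?_ (hc0 σ)
          exact_mod_cast perm_weight G C w W hW σ (hsupp σ h)
  nlinarith

open Classical in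
theorem matching_row {V : Type*} [Fintype V] (G : SimpleGraph V) (M : Finset (Sym2 V))
    (hM : IsPerfectMatchingSet G M) (u : V) :
    ∑ v, (if s(u, v) ∈ M then (1 : ℚ) else 0) = 1 := by
  obtain ⟨e, ⟨he, hu⟩, huniq⟩ := hM.2 u
  obtain ⟨x, rfl⟩ := Sym2.mem_iff_exists.1 hu
  rw [Finset.sum_eq_single x]
  · simp [he]
  · intro b _ hb
    rw [if_neg]
    intro hbM
    have := huniq _ ⟨hbM, by simp⟩
    exact hb (Sym2.congr_right.1 this)
  · simp

open Classical in
theorem matching_wt {V : Type*} [Fintype V] (G : SimpleGraph V) (w : Sym2 V → ℤ)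
    (M : Finset (Sym2 V)) (hM : IsPerfectMatchingSet G M) :
    ∑ u, ∑ v, (if s(u, v) ∈ M then (1 : ℚ) else 0) * w s(u, v) = 2 * ((∑ e ∈ M, w e : ℤ) : ℚ) := by
  have h1 : ∀ u v, (if s(u, v) ∈ M then (1 : ℚ) else 0) * w s(u, v) =
      ∑ e ∈ M, if e = s(u, v) then (w e : ℚ) else 0 := by
    intro u v
    simp
  simp only [h1]
  push_cast
  rw [Finset.mul_sum]
  have h2 : ∀ u, ∑ v, ∑ e ∈ M, (if e = s(u, v) then (w e : ℚ) else 0) =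
     ∑ e ∈ M, ∑ v, (if e = s(u, v) then (w e : ℚ) else 0) := fun u => Finset.sum_comm
  simp only [h2]
  rw [Finset.sum_comm]
  refine Finset.sum_congr rfl fun e he => ?_
  have hadj := hM.1 he
  induction e with | _ a b
  have hab : a ≠ b := (G.mem_edgeSet.1 hadj).ne
  have h3 : ∀ u v, (if s(a, b) = s(u, v) then (w s(a, b) : ℚ) else 0) =
      (if a = u then (if b = v then (w s(a, b) : ℚ) else 0) else 0)
      + (if b = u then (if a = v then (w s(a, b) : ℚ) else 0) else 0) := by
    intro u v
    simp only [Sym2.eq_iff]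
    by_cases h1 : a = u <;> by_cases h2 : b = v <;> by_cases h3 : a = v <;> by_cases h4 : b = u <;>
      simp_all
  simp only [h3, Finset.sum_add_distrib]
  have h4 : ∀ p q : V, ∑ u, ∑ v, (if p = u then (if q = v then (w s(a, b) : ℚ) else 0) else 0)
      = w s(a, b) := by
    intro p q
    rw [Finset.sum_eq_single p] <;> simp +contextual [eq_comm]
  rw [h4, h4]
  ring

open Classical in
/-- The signed matrix of a walk. -/
theorem walk_matrix {V : Type*} [Fintype V] (G : SimpleGraph V) (w : Sym2 V → ℤ)
    (ε : V → ℚ) (hε : ∀ u v, G.Adj u v → ε v = - ε u) (hε1 : ∀ u, |ε u| = 1)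
    {a b : V} (p : G.Walk a b) :
    ∃ S : V → V → ℚ, (∀ u v, S u v = S v u) ∧
      (∀ x, ∑ y, S x y = (if x = a then ε a else 0) - (if x = b then ε b else 0)) ∧
      (∀ x y, |S x y| ≤ 2 * p.length) ∧ (∀ x y, s(x, y) ∉ p.edges → S x y = 0) ∧
      ∑ x, ∑ y, S x y * w s(x, y) = 2 * ε a * (altSum w p.edges : ℤ) := by
  induction p with
  | nil => exact ⟨fun _ _ => 0, by simp, by simp, by simp, by simp, by simp [altSum]⟩
  | @cons a c b h p ih =>
    obtain ⟨S, hs, hr, hb, hsupp, hw⟩ := ih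
    have hac := hε _ _ h
    let T : V → V → ℚ := fun x y => (if x = a then (if y = c then ε a else 0) else 0)
      + (if x = c then (if y = a then ε a else 0) else 0)
    refine ⟨fun x y => T x y + S x y, ?_, ?_, ?_, ?_, ?_⟩
    · intro u v
      have : T u v = T v u := by
        simp only [T]
        split_ifs <;> simp
      show _ + _ = _ + _
      rw [this, hs]
    · intro x
      rw [Finset.sum_add_distrib, hr, hac]
      simp only [T, Finset.sum_add_distrib]
      by_cases h1 : x = a <;> by_cases h2 : x = c <;> simp [h1, h2] <;> split_ifs <;> ring
    · intro x y
      have h1 := hb x y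
      have h2 : |T x y| ≤ 2 := by
        have := hε1 a
        simp only [T]
        refine (abs_add_le _ _).trans ?_
        split_ifs <;> simp [this] <;> norm_num
      refine (abs_add_le _ _).trans ?_
      rw [SimpleGraph.Walk.length_cons]
      push_cast
      linarith
    · intro x y hxy
      rw [SimpleGraph.Walk.edges_cons, List.mem_cons, not_or] at hxy
      show _ + _ = _
      rw [hsupp x y hxy.2, add_zero]
      have h1 : ¬ (x = a ∧ y = c) := by
        rintro ⟨rfl, rfl⟩
        exact hxy.1 rfl
      have h2 : ¬ (x = c ∧ y = a) := by
        rintro ⟨rfl, rfl⟩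
        exact hxy.1 Sym2.eq_swap
      simp only [T]
      split_ifs <;> simp_all
    · simp only [add_mul, Finset.sum_add_distrib]
      rw [hw, hac, SimpleGraph.Walk.edges_cons]
      have h4 : ∀ p q : V, ∑ x, ∑ y,
          (if x = p then (if y = q then ε a else 0) else 0) * (w s(x, y) : ℚ)
          = ε a * w s(p, q) := by
        intro p q
        rw [Finset.sum_eq_single p] <;> simp +contextual
      simp only [T, add_mul, Finset.sum_add_distrib, h4]
      rw [Sym2.eq_swap (a := c) (b := a), altSum]
      push_cast
      ring

/-- Lemma (FGT): in a bipartite graph, if `E₁` is the union of all minimum-weight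
perfect matchings, then (a) no cycle with non-zero circulation survives in `E₁`, and
(b) every perfect matching inside `E₁` has minimum weight. -/
theorem min_weight_pm_union (V : Type*) [Fintype V] (G : SimpleGraph V)
    (hbip : G.Colorable 2) (w : Sym2 V → ℤ) (Wstar : ℤ)
    (hW : IsLeast {x : ℤ | ∃ M : Finset (Sym2 V),
        IsPerfectMatchingSet G M ∧ ∑ e ∈ M, w e = x} Wstar)
    (E₁ : Set (Sym2 V))
    (hE₁ : E₁ = {e : Sym2 V | ∃ M : Finset (Sym2 V),
        IsPerfectMatchingSet G M ∧ ∑ e' ∈ M, w e' = Wstar ∧ e ∈ M}) :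
    (∀ (v : V) (c : G.Walk v v), c.IsCycle → |altSum w c.edges| ≠ 0 →
        ∃ e ∈ c.edges, e ∉ E₁) ∧
    (∀ M : Finset (Sym2 V), IsPerfectMatchingSet G M → (∀ e ∈ M, e ∈ E₁) →
        ∑ e ∈ M, w e = Wstar) := by
  classical
  obtain ⟨C⟩ := hbip
  have hlow : ∀ M : Finset (Sym2 V), IsPerfectMatchingSet G M → Wstar ≤ ∑ e ∈ M, w e :=
    fun M hM => hW.2 ⟨M, hM, rfl⟩
  let P : Finset (Finset (Sym2 V)) := Finset.univ.filter
    (fun M => IsPerfectMatchingSet G M ∧ ∑ e ∈ M, w e = Wstar)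
  have hP : ∀ M ∈ P, IsPerfectMatchingSet G M ∧ ∑ e ∈ M, w e = Wstar := fun M hM => by
    simpa [P] using hM
  let X : V → V → ℚ := fun u v => ∑ M ∈ P, if s(u, v) ∈ M then (1 : ℚ) else 0
  have hXs : ∀ u v, X u v = X v u := fun u v => by simp only [X, Sym2.eq_swap]
  have hX0 : ∀ u v, 0 ≤ X u v := fun u v =>
    Finset.sum_nonneg fun M _ => by split_ifs <;> norm_num
  have hXG : ∀ u v, ¬ G.Adj u v → X u v = 0 := by
    intro u v h
    refine Finset.sum_eq_zero fun M hM => ?_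
    rw [if_neg]
    exact fun h' => h ((hP M hM).1.1 h')
  have hXr : ∀ u, ∑ v, X u v = (P.card : ℚ) := by
    intro u
    simp only [X]
    rw [Finset.sum_comm, Finset.sum_congr rfl (fun M hM => matching_row G M (hP M hM).1 u)]
    simp
  have hX1 : ∀ u v, s(u, v) ∈ E₁ → 1 ≤ X u v := by
    intro u v h
    rw [hE₁] at h
    obtain ⟨M, hM, hMw, he⟩ := h
    have := Finset.single_le_sum (f := fun M => if s(u, v) ∈ M then (1 : ℚ) else 0) (s := P)
      (fun M _ => by split_ifs <;> norm_num) (a := M) (by simp [P, hM, hMw])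
    rw [if_pos he] at this
    exact this
  have hXw : ∑ u, ∑ v, X u v * w s(u, v) = 2 * P.card * Wstar := by
    simp only [X, Finset.sum_mul]
    have h2 : ∀ u, ∑ v, ∑ M ∈ P, (if s(u, v) ∈ M then (1 : ℚ) else 0) * w s(u, v) =
       ∑ M ∈ P, ∑ v, (if s(u, v) ∈ M then (1 : ℚ) else 0) * w s(u, v) :=
       fun u => Finset.sum_comm
    simp only [h2]
    rw [Finset.sum_comm, Finset.sum_congr rfl (fun M hM => (matching_wt G w M (hP M hM).1).trans
      (by rw [(hP M hM).2]))]
    simp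
    ring
  clear_value X
  have reg := regular_weight G C w Wstar hlow
  constructor
  · intro v c _ hne
    by_contra! hall
    apply hne
    rw [abs_eq_zero]
    let ε : V → ℚ := fun v => if C v = 0 then 1 else -1
    have hε : ∀ u v, G.Adj u v → ε v = - ε u := by
      intro u v h
      have := C.valid h
      simp only [ε]
      split_ifs <;> first | omega | norm_num
    have hε1 : ∀ u, |ε u| = 1 := by
      intro u
      simp only [ε]
      split_ifs <;> simp
    obtain ⟨S, hs, hr, hb, hsupp, hw⟩ := walk_matrix G w ε hε hε1 c
    have main : ∀ t : ℚ, |t| = 1 → 0 ≤ t * (2 * ε v * (altSum w c.edges : ℤ)) := by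
      intro t ht
      have hrow : ∀ u, ∑ v, ((2 * c.length : ℚ) * X u v + t * S u v) =
          2 * c.length * P.card := by
        intro u
        rw [Finset.sum_add_distrib, ← Finset.mul_sum, ← Finset.mul_sum, hXr, hr]
        simp
      have := reg (fun u v => (2 * c.length : ℚ) * X u v + t * S u v)
        (2 * c.length * P.card) (by positivity) ?_ ?_ hrow ?_
      · simp only [add_mul, Finset.sum_add_distrib, mul_assoc, ← Finset.mul_sum] at this
        rw [hw, hXw] at this
        linarith
      · intro x y
        by_cases hxy : s(x, y) ∈ c.edges
        · have h1 := hX1 x y (hall _ hxy)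
          have h2 : |t * S x y| ≤ 2 * c.length := by
            rw [abs_mul, ht, one_mul]
            exact hb x y
          have h3 := (abs_le.1 h2).1
          have h4 : (0 : ℚ) ≤ 2 * c.length := by positivity
          show 0 ≤ _ + _
          nlinarith
        · show 0 ≤ _ + _
          rw [hsupp x y hxy, mul_zero, add_zero]
          exact mul_nonneg (by positivity) (hX0 x y)
      · intro x y hxy
        show _ + _ = _
        rw [hXG x y hxy, hsupp x y (fun h => hxy (c.adj_of_mem_edges h))]
        simp
      · intro y
        rw [← hrow y]
        exact Finset.sum_congr rfl fun x _ => by rw [hXs, hs]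
    have h1 := main 1 (by simp)
    have h2 := main (-1) (by simp)
    have h3 : 2 * ε v * ((altSum w c.edges : ℤ) : ℚ) = 0 := by linarith
    have h4 : ε v ≠ 0 := by
      intro h
      have := hε1 v
      simp [h] at this
    have h5 : ((altSum w c.edges : ℤ) : ℚ) = 0 := by
      rcases mul_eq_zero.1 h3 with h | h
      · exact absurd h (by simpa using h4)
      · exact h
    exact_mod_cast h5
  · intro M hM hME
    refine le_antisymm ?_ (hlow M hM)
    have hrow : ∀ u, ∑ v, (X u v - if s(u, v) ∈ M then (1 : ℚ) else 0) = P.card - 1 := by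
      intro u
      rw [Finset.sum_sub_distrib, hXr, matching_row G M hM]
    have hpos : 1 ≤ P.card := by
      obtain ⟨M₀, h0, h1⟩ := hW.1
      exact Finset.card_pos.2 ⟨M₀, by simp [P, h0, h1]⟩
    have := reg (fun u v => X u v - if s(u, v) ∈ M then (1 : ℚ) else 0) (P.card - 1) ?_ ?_ ?_
      hrow ?_
    · have hsplit : ∑ u, ∑ v, (X u v - if s(u, v) ∈ M then (1 : ℚ) else 0) * w s(u, v) =
          ∑ u, ∑ v, X u v * w s(u, v)
          - ∑ u, ∑ v, (if s(u, v) ∈ M then (1 : ℚ) else 0) * w s(u, v) := by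
        rw [← Finset.sum_sub_distrib]
        refine Finset.sum_congr rfl fun u _ => ?_
        rw [← Finset.sum_sub_distrib]
        exact Finset.sum_congr rfl fun v _ => sub_mul _ _ _
      rw [hsplit, hXw] at this
      have h2 := matching_wt G w M hM
      rw [h2] at this
      have h3 : ((∑ e ∈ M, w e : ℤ) : ℚ) ≤ Wstar := by linarith
      exact_mod_cast h3
    · have : (1 : ℚ) ≤ P.card := by exact_mod_cast hpos
      linarith
    · intro u v
      show 0 ≤ _ - _
      split_ifs with h
      · have := hX1 u v (hME _ h)
        linarith
      · have := hX0 u v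
        linarith
    · intro u v h
      show _ - _ = _
      rw [hXG u v h, if_neg (fun h' : s(u, v) ∈ M => h (hM.1 h'))]
      simp
    · intro v
      rw [← hrow v]
      exact Finset.sum_congr rfl fun x _ => by rw [hXs, Sym2.eq_swap]
end

section
/- Let G = (V, E) be a finite simple bipartite graph with a weight function w : E → ℤ. If every cycle C of G has circulation c_w(C) ≠ 0, then G has at most one perfect matching attaining the minimum weight; i.e., w isolates a perfect matching. -/
/-- The mate function of a perfect matching. -/
lemma exists_mate {V : Type*} {G : SimpleGraph V} {M : Finset (Sym2 V)}
    (hM : IsPerfectMatchingSet G M) :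
    ∃ m : V → V, (∀ v, s(v, m v) ∈ M) ∧ (∀ v e, e ∈ M → v ∈ e → e = s(v, m v)) ∧
      (∀ v, G.Adj v (m v)) ∧ (∀ v, m (m v) = v) := by
  have h1 : ∀ v, ∃ u, s(v, u) ∈ M := by
    intro v
    obtain ⟨e, ⟨he, hv⟩, -⟩ := hM.2 v
    obtain ⟨u, rfl⟩ := hv
    exact ⟨u, he⟩
  choose m hm using h1
  have h2 : ∀ v e, e ∈ M → v ∈ e → e = s(v, m v) := fun v e he hv =>
    (hM.2 v).unique ⟨he, hv⟩ ⟨hm v, Sym2.mem_mk_left _ _⟩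
  have h3 : ∀ v, G.Adj v (m v) := fun v => by
    have := hM.1 (hm v)
    simpa using this
  refine ⟨m, hm, h2, h3, fun v => ?_⟩
  have h4 := h2 (m v) _ (hm v) (Sym2.mem_mk_right _ _)
  have h5 := (h3 v).ne
  rw [Sym2.eq_iff] at h4
  grind

/-- Exchanging parts of perfect matchings covering the same vertices. -/
lemma exchange_le {V : Type*} {G : SimpleGraph V} (w : Sym2 V → ℤ) {M M' F F' : Finset (Sym2 V)}
    (hM : IsPerfectMatchingSet G M) (hM' : IsPerfectMatchingSet G M')
    (hmin : ∀ N : Finset (Sym2 V), IsPerfectMatchingSet G N → ∑ e ∈ M, w e ≤ ∑ e ∈ N, w e)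
    (hF : F ⊆ M) (hF' : F' ⊆ M')
    (hc : ∀ v, (∃ e ∈ F, v ∈ e) ↔ (∃ e ∈ F', v ∈ e)) :
    ∑ e ∈ F, w e ≤ ∑ e ∈ F', w e := by
  classical
  have hdisj : Disjoint (M \ F) F' := by
    rw [Finset.disjoint_left]
    intro e he he'
    rw [Finset.mem_sdiff] at he
    induction e using Sym2.ind with
    | _ x y =>
      obtain ⟨f, hf, hxf⟩ := (hc x).2 ⟨_, he', Sym2.mem_mk_left _ _⟩
      have := (hM.2 x).unique ⟨he.1, Sym2.mem_mk_left _ _⟩ ⟨hF hf, hxf⟩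
      exact he.2 (this ▸ hf)
  have hN : IsPerfectMatchingSet G ((M \ F) ∪ F') := by
    refine ⟨?_, fun v => ?_⟩
    · intro e he
      simp only [Finset.coe_union, Finset.coe_sdiff, Set.mem_union, Set.mem_sdiff,
        Finset.mem_coe] at he
      rcases he with he | he
      · exact hM.1 he.1
      · exact hM'.1 (hF' he)
    · by_cases hv : ∃ e ∈ F', v ∈ e
      · obtain ⟨f, hf, hvf⟩ := (hc v).2 hv
        obtain ⟨e, he, hve⟩ := hv
        refine ⟨e, ⟨Finset.mem_union_right _ he, hve⟩, ?_⟩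
        rintro g ⟨hg, hvg⟩
        rw [Finset.mem_union, Finset.mem_sdiff] at hg
        rcases hg with hg | hg
        · have := (hM.2 v).unique ⟨hg.1, hvg⟩ ⟨hF hf, hvf⟩
          exact absurd (this ▸ hf) hg.2
        · exact (hM'.2 v).unique ⟨hF' hg, hvg⟩ ⟨hF' he, hve⟩
      · have hv' := mt (hc v).1 hv
        obtain ⟨e, ⟨he, hve⟩, hu⟩ := hM.2 v
        refine ⟨e, ⟨Finset.mem_union_left _ (Finset.mem_sdiff.2 ⟨he, fun h => hv' ⟨e, h, hve⟩⟩),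
          hve⟩, ?_⟩
        rintro g ⟨hg, hvg⟩
        rw [Finset.mem_union, Finset.mem_sdiff] at hg
        rcases hg with hg | hg
        · exact hu g ⟨hg.1, hvg⟩
        · exact absurd ⟨g, hg, hvg⟩ hv
  have h1 := hmin _ hN
  rw [Finset.sum_union hdisj] at h1
  have h2 := Finset.sum_sdiff (f := w) hF
  linarith

/-- The alternating walk following the orbit of `a` under `m₂ ∘ m₁`. -/
lemma exists_walk {V : Type*} {G : SimpleGraph V} (w : Sym2 V → ℤ) (c : V → Fin 2)
    (hcol : ∀ u v, G.Adj u v → c u ≠ c v)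
    (m₁ m₂ : V → V) (h₁ : ∀ v, G.Adj v (m₁ v)) (h₂ : ∀ v, G.Adj v (m₂ v))
    (i₁ : ∀ v, m₁ (m₁ v) = v) (σ : V → V) (hσ : ∀ v, σ v = m₂ (m₁ v)) (n : ℕ) :
    ∀ a b, b = σ^[n] a → (∀ i j, i < j → j ≤ n → σ^[i] a ≠ σ^[j] a) →
    ∃ p : G.Walk a b, p.IsPath ∧
      altSum w p.edges = ∑ i ∈ Finset.range n,
        (w s(σ^[i] a, m₁ (σ^[i] a)) - w s(m₁ (σ^[i] a), σ^[i+1] a)) ∧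
      (∀ v ∈ p.support, (∃ i ≤ n, v = σ^[i] a) ∨ (∃ i < n, v = m₁ (σ^[i] a))) := by
  have hcs : ∀ n a, c (σ^[n] a) = c a := by
    intro n
    induction n with
    | zero => intro a; rfl
    | succ n ih =>
      intro a
      rw [Function.iterate_succ_apply, ih, hσ]
      have e1 := hcol _ _ (h₁ a)
      have e2 := hcol _ _ (h₂ (m₁ a))
      omega
  have hcm : ∀ a, c (m₁ a) ≠ c a := fun a => (hcol _ _ (h₁ a)).symm
  induction n with
  | zero =>
    rintro a b rfl -
    exact ⟨.nil, by simp, by simp [altSum], fun v hv => Or.inl ⟨0, le_rfl, by simpa using hv⟩⟩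
  | succ n ih =>
    intro a b hb hinj
    obtain ⟨p, hp, hs, hv⟩ := ih (σ a) b hb (fun i j hij hj => by
      have := hinj (i+1) (j+1) (by omega) (by omega)
      simpa [Function.iterate_succ_apply] using this)
    have hadj : G.Adj (m₁ a) (σ a) := by rw [hσ]; exact h₂ _
    refine ⟨.cons (h₁ a) (.cons hadj p), ?_, ?_, ?_⟩
    · rw [SimpleGraph.Walk.cons_isPath_iff, SimpleGraph.Walk.cons_isPath_iff]
      refine ⟨⟨hp, fun h => ?_⟩, fun h => ?_⟩
      · rcases hv _ h with ⟨i, hi, he⟩ | ⟨i, hi, he⟩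
        · have := congrArg c he
          rw [← Function.iterate_succ_apply, hcs] at this
          exact hcm _ this
        · have := congrArg m₁ he
          rw [i₁, i₁, ← Function.iterate_succ_apply] at this
          exact hinj 0 (i+1) (by omega) (by omega) this
      · rw [SimpleGraph.Walk.support_cons, List.mem_cons] at h
        rcases h with h | h
        · exact hcm a (congrArg c h.symm)
        · rcases hv _ h with ⟨i, hi, he⟩ | ⟨i, hi, he⟩
          · rw [← Function.iterate_succ_apply] at he
            exact hinj 0 (i+1) (by omega) (by omega) he
          · have := congrArg c he
            rw [← Function.iterate_succ_apply] at this
            have h3 := hcm (σ^[i+1] a)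
            rw [hcs] at h3
            exact h3 this.symm
    · rw [SimpleGraph.Walk.edges_cons, SimpleGraph.Walk.edges_cons, altSum, altSum, hs,
        Finset.sum_range_succ']
      simp only [Function.iterate_succ_apply, Function.iterate_zero, id]
      ring
    · intro v h
      simp only [SimpleGraph.Walk.support_cons, List.mem_cons] at h
      rcases h with h | h | h
      · exact Or.inl ⟨0, by omega, h⟩
      · exact Or.inr ⟨0, by omega, h⟩
      · rcases hv _ h with ⟨i, hi, he⟩ | ⟨i, hi, he⟩
        · exact Or.inl ⟨i+1, by omega, he⟩
        · exact Or.inr ⟨i+1, by omega, he⟩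

/-- If every cycle of a finite bipartite graph has non-zero circulation, then the
weight function isolates a perfect matching: at most one perfect matching attains
the minimum weight. -/
theorem nonzero_circulation_isolates (V : Type*) [Fintype V] (G : SimpleGraph V)
    (hbip : G.Colorable 2) (w : Sym2 V → ℤ)
    (hcirc : ∀ (v : V) (c : G.Walk v v), c.IsCycle → |altSum w c.edges| ≠ 0) :
    ∀ M₁ M₂ : Finset (Sym2 V), IsPerfectMatchingSet G M₁ → IsPerfectMatchingSet G M₂ →
      (∀ M : Finset (Sym2 V), IsPerfectMatchingSet G M → ∑ e ∈ M₁, w e ≤ ∑ e ∈ M, w e) →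
      (∀ M : Finset (Sym2 V), IsPerfectMatchingSet G M → ∑ e ∈ M₂, w e ≤ ∑ e ∈ M, w e) →
      M₁ = M₂ := by
  intro M₁ M₂ hM₁ hM₂ hmin₁ hmin₂
  classical
  obtain ⟨C⟩ := hbip
  have hcol : ∀ u v, G.Adj u v → C u ≠ C v := fun u v h => C.valid h
  obtain ⟨m₁, hm₁, hu₁, ha₁, hi₁⟩ := exists_mate hM₁
  obtain ⟨m₂, hm₂, hu₂, ha₂, hi₂⟩ := exists_mate hM₂
  by_cases hall : ∀ v, m₁ v = m₂ v
  · ext e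
    induction e using Sym2.ind with
    | _ x y =>
      constructor
      · intro h
        rw [hu₁ x _ h (Sym2.mem_mk_left _ _), hall]
        exact hm₂ x
      · intro h
        rw [hu₂ x _ h (Sym2.mem_mk_left _ _), ← hall]
        exact hm₁ x
  · exfalso
    push Not at hall
    obtain ⟨a, hne⟩ := hall
    obtain ⟨σ, hσ⟩ : ∃ σ : V → V, ∀ v, σ v = m₂ (m₁ v) := ⟨fun v => m₂ (m₁ v), fun _ => rfl⟩
    have hσinj : Function.Injective σ := by
      intro x y h
      rw [hσ, hσ] at h
      have := congrArg (fun z => m₁ (m₂ z)) h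
      simpa [hi₁, hi₂] using this
    have hper : a ∈ Function.periodicPts σ := hσinj.mem_periodicPts a
    have hσa : σ a ≠ a := by
      intro h
      rw [hσ] at h
      have := congrArg m₂ h
      rw [hi₂] at this
      exact hne this
    have hkpos := Function.minimalPeriod_pos_of_mem_periodicPts hper
    have hk1 : Function.minimalPeriod σ a ≠ 1 := fun h =>
      hσa (Function.minimalPeriod_eq_one_iff_isFixedPt.1 h)
    have hinj := Function.iterate_injOn_Iio_minimalPeriod (f := σ) (x := a)
    have hend := Function.iterate_minimalPeriod (f := σ) (x := a)
    obtain ⟨k, hk⟩ : ∃ k, Function.minimalPeriod σ a = k + 1 := ⟨_, (Nat.succ_pred_eq_of_pos hkpos).symm⟩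
    rw [hk] at hinj hend hk1
    have hinj' : ∀ i j, i < k + 1 → j < k + 1 → σ^[i] a = σ^[j] a → i = j :=
      fun i j hi hj h => hinj hi hj h
    have hcs : ∀ n, C (σ^[n] a) = C a := by
      intro n
      induction n with
      | zero => rfl
      | succ n ih =>
        rw [Function.iterate_succ_apply', hσ]
        have e1 := hcol _ _ (ha₁ (σ^[n] a))
        have e2 := hcol _ _ (ha₂ (m₁ (σ^[n] a)))
        omega
    have hcm : ∀ n, C (m₁ (σ^[n] a)) ≠ C a := fun n => by
      rw [← hcs n]; exact (hcol _ _ (ha₁ _)).symm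
    have hsucc : ∀ n, σ^[n+1] a = m₂ (m₁ (σ^[n] a)) := fun n => by
      rw [Function.iterate_succ_apply', hσ]
    -- the walk around the orbit
    obtain ⟨p, hp, hs, hv⟩ := exists_walk w C hcol m₁ m₂ ha₁ ha₂ hi₁ σ hσ k (σ a) a
      (by rw [← Function.iterate_succ_apply]; exact hend.symm) (by
        intro i j hij hj h
        rw [← Function.iterate_succ_apply, ← Function.iterate_succ_apply] at h
        by_cases hjk : j = k
        · subst hjk
          rw [Nat.succ_eq_add_one j, hend] at h
          have := hinj' (i+1) 0 (by omega) (by omega) h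
          omega
        · have := hinj' (i+1) (j+1) (by omega) (by omega) h
          omega)
    have hadj : G.Adj (m₁ a) (σ a) := by rw [hσ]; exact ha₂ _
    have hmp : m₁ a ∉ p.support := by
      intro h
      rcases hv _ h with ⟨i, hi, he⟩ | ⟨i, hi, he⟩
      · have := congrArg C he
        rw [← Function.iterate_succ_apply, hcs] at this
        exact hcm 0 this
      · have := congrArg m₁ he
        rw [hi₁, hi₁, ← Function.iterate_succ_apply] at this
        have := hinj' 0 (i+1) (by omega) (by omega) this
        omega
    have hcyc : (SimpleGraph.Walk.cons (ha₁ a) (SimpleGraph.Walk.cons hadj p)).IsCycle := by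
      rw [SimpleGraph.Walk.cons_isCycle_iff, SimpleGraph.Walk.cons_isPath_iff]
      refine ⟨⟨hp, hmp⟩, fun h => ?_⟩
      rw [SimpleGraph.Walk.edges_cons, List.mem_cons] at h
      rcases h with h | h
      · rw [Sym2.eq_iff] at h
        have := (ha₁ a).ne
        grind
      · exact hmp (p.snd_mem_support_of_mem_edges h)
    have hsum : altSum w (SimpleGraph.Walk.cons (ha₁ a) (SimpleGraph.Walk.cons hadj p)).edges =
        ∑ i ∈ Finset.range (k+1),
        (w s(σ^[i] a, m₁ (σ^[i] a)) - w s(m₁ (σ^[i] a), σ^[i+1] a)) := by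
      rw [SimpleGraph.Walk.edges_cons, SimpleGraph.Walk.edges_cons, altSum, altSum, hs,
        Finset.sum_range_succ']
      simp only [Function.iterate_succ_apply, Function.iterate_zero, id]
      ring
    have hnz := hcirc _ _ hcyc
    rw [hsum, Finset.sum_sub_distrib] at hnz
    have hF₁ : ∑ e ∈ (Finset.range (k+1)).image (fun i => s(σ^[i] a, m₁ (σ^[i] a))), w e =
        ∑ i ∈ Finset.range (k+1), w s(σ^[i] a, m₁ (σ^[i] a)) := by
      apply Finset.sum_image
      intro i hi j hj h
      simp only [Finset.coe_range, Set.mem_Iio] at hi hj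
      rw [Sym2.eq_iff] at h
      rcases h with h | h
      · exact hinj' i j hi hj h.1
      · have := congrArg C h.1
        rw [hcs] at this
        exact absurd this.symm (hcm j)
    have hF₂ : ∑ e ∈ (Finset.range (k+1)).image (fun i => s(m₁ (σ^[i] a), σ^[i+1] a)), w e =
        ∑ i ∈ Finset.range (k+1), w s(m₁ (σ^[i] a), σ^[i+1] a) := by
      apply Finset.sum_image
      intro i hi j hj h
      simp only [Finset.coe_range, Set.mem_Iio] at hi hj
      rw [Sym2.eq_iff] at h
      rcases h with h | h
      · have := congrArg m₁ h.1
        rw [hi₁, hi₁] at this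
        exact hinj' i j hi hj this
      · have := congrArg C h.1
        rw [hcs] at this
        exact absurd this (hcm i)
    have hs₁ : (Finset.range (k+1)).image (fun i => s(σ^[i] a, m₁ (σ^[i] a))) ⊆ M₁ := by
      intro e he
      obtain ⟨i, -, rfl⟩ := Finset.mem_image.1 he
      exact hm₁ _
    have hs₂ : (Finset.range (k+1)).image (fun i => s(m₁ (σ^[i] a), σ^[i+1] a)) ⊆ M₂ := by
      intro e he
      obtain ⟨i, -, rfl⟩ := Finset.mem_image.1 he
      simp only [hsucc]
      exact hm₂ _
    have hcov : ∀ v, (∃ e ∈ (Finset.range (k+1)).image (fun i => s(σ^[i] a, m₁ (σ^[i] a))), v ∈ e) ↔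
        (∃ e ∈ (Finset.range (k+1)).image (fun i => s(m₁ (σ^[i] a), σ^[i+1] a)), v ∈ e) := by
      intro v
      simp only [Finset.mem_image, Finset.mem_range, exists_exists_and_eq_and, Sym2.mem_iff]
      constructor
      · rintro ⟨i, hi, h | h⟩
        · cases i with
          | zero => exact ⟨k, by omega, Or.inr (by rw [hend]; exact h)⟩
          | succ i => exact ⟨i, by omega, Or.inr h⟩
        · exact ⟨i, hi, Or.inl h⟩
      · rintro ⟨i, hi, h | h⟩
        · exact ⟨i, hi, Or.inr h⟩
        · by_cases hik : i = k
          · subst hik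
            exact ⟨0, by omega, Or.inl (by rw [h, hend]; rfl)⟩
          · exact ⟨i+1, by omega, Or.inl h⟩
    have l1 := exchange_le w hM₁ hM₂ hmin₁ hs₁ hs₂ hcov
    have l2 := exchange_le w hM₂ hM₁ hmin₂ hs₂ hs₁ (fun v => (hcov v).symm)
    rw [hF₁, hF₂] at l1 l2
    exact hnz (by rw [abs_eq_zero]; linarith)
end

section
/- Let T be an n×n matrix with entries in 𝔽₂[X] such that T(i,i) ≠ 0 for every i, and such that for every permutation σ of {1,…,n} with σ ≠ id and ∏_i T(i,σ(i)) ≠ 0, the degree of ∏_i T(i,σ(i)) is strictly less than D := deg(∏_i T(i,i)). Then the coefficient of X^D in det(T) equals 1; in particular det(T) ≠ 0. -/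
open Polynomial in
theorem det_dominant_diagonal (n : ℕ) (T : Matrix (Fin n) (Fin n) (Polynomial (ZMod 2)))
    (hdiag : ∀ i, T i i ≠ 0)
    (hdom : ∀ σ : Equiv.Perm (Fin n), σ ≠ 1 → (∏ i, T i (σ i)) ≠ 0 →
      (∏ i, T i (σ i)).natDegree < (∏ i, T i i).natDegree) :
    T.det.coeff (∏ i, T i i).natDegree = 1 ∧ T.det ≠ 0 := by
  have key : T.det.coeff (∏ i, T i i).natDegree = 1 := by
    rw [← Matrix.det_transpose, Matrix.det_apply, Polynomial.finset_sum_coeff,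
      Finset.sum_eq_single (1 : Equiv.Perm (Fin n))]
    · have h0 : (∏ i, T i i) ≠ 0 := Finset.prod_ne_zero_iff.mpr fun i _ => hdiag i
      have h1 : (∏ i, T i i).leadingCoeff ≠ 0 := leadingCoeff_ne_zero.mpr h0
      have h2 : ∀ a : ZMod 2, a ≠ 0 → a = 1 := by decide
      simpa using h2 _ h1
    · intro σ _ hσ
      have h3 : (∏ i, T i (σ i)).coeff (∏ i, T i i).natDegree = 0 := by
        by_cases h : (∏ i, T i (σ i)) = 0
        · rw [h, coeff_zero]
        · exact coeff_eq_zero_of_natDegree_lt (hdom σ hσ h)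
      simp only [Matrix.transpose_apply]
      rcases Int.units_eq_one_or (Equiv.Perm.sign σ) with hs | hs <;> simp [hs, h3]
    · simp
  refine ⟨key, fun h => ?_⟩
  rw [h, coeff_zero] at key
  exact zero_ne_one key
end
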